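/- The curvature of the Γ-linear connection ∇ satisfies, for all i, j, k: R(∂/∂y^k, δ/δx^j) δ/δx^i = Σ_l P^l_{ijk} · δ/δx^l, where P^l_{ijk} := ∂L^l_{ij}/∂y^k − C^l_{ik|j} + Σ_r C^l_{ir} P^r_{jk}, with C^l_{ik|j} := δC^l_{ik}/δx^j + Σ_r C^r_{ik} L^l_{rj} − Σ_r C^l_{rk} L^r_{ij} − Σ_r C^l_{ir} Lv^r_{kj} and P^r_{jk} := ∂N^r_j/∂y^k − Lv^r_{kj}. -/

import Mathlib

noncomputable section
open scoped BigOperators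

/-- The local model `E = ℝ × (Fin n → ℝ) × (Fin n → ℝ)` of the 1-jet space `J¹(ℝ,M)`,
with coordinates `(t, x, y)`. -/
abbrev E (n : ℕ) : Type := ℝ × (Fin n → ℝ) × (Fin n → ℝ)

variable {n : ℕ}

/-- Partial derivative `∂f/∂t`. -/
def pT (f : E n → ℝ) (p : E n) : ℝ := fderiv ℝ f p (1, 0, 0)

/-- Partial derivative `∂f/∂x^i`. -/
def pX (f : E n → ℝ) (i : Fin n) (p : E n) : ℝ := fderiv ℝ f p (0, Pi.single i 1, 0)

/-- Partial derivative `∂f/∂y^i`. -/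
def pY (f : E n → ℝ) (i : Fin n) (p : E n) : ℝ := fderiv ℝ f p (0, 0, Pi.single i 1)

/-- The adapted temporal frame field `δ/δt = ∂/∂t - Σ_j M^j ∂/∂y^j`. -/
def delT (M : E n → Fin n → ℝ) (p : E n) : E n := (1, 0, fun j => -(M p j))

/-- The adapted spatial frame field `δ/δx^i = ∂/∂x^i - Σ_j N^j_i ∂/∂y^j`. -/
def delX (N : E n → Fin n → Fin n → ℝ) (i : Fin n) (p : E n) : E n :=
  (0, Pi.single i 1, fun j => -(N p i j))

/-- The vertical frame field `∂/∂y^i`. -/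
def delY (i : Fin n) (p : E n) : E n := ((0 : ℝ), (0 : Fin n → ℝ), Pi.single i 1)

/-- The Lie bracket `[X,Y](p) = (DY)(p)(X(p)) - (DX)(p)(Y(p))` of vector fields on `E`. -/
def lieBr (X Y : E n → E n) (p : E n) : E n := fderiv ℝ Y p (X p) - fderiv ℝ X p (Y p)

/-- `δf/δt := ∂f/∂t - Σ_k M^k ∂f/∂y^k`. -/
def dT (M : E n → Fin n → ℝ) (f : E n → ℝ) (p : E n) : ℝ :=
  pT f p - ∑ k, M p k * pY f k p

/-- `δf/δx^i := ∂f/∂x^i - Σ_k N^k_i ∂f/∂y^k`. -/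
def dX (N : E n → Fin n → Fin n → ℝ) (f : E n → ℝ) (i : Fin n) (p : E n) : ℝ :=
  pX f i p - ∑ k, N p i k * pY f k p

/-- A d-vector field `X = a·δ/δt + Σ_i b^i·δ/δx^i + Σ_i c^i·∂/∂y^i`
given by its adapted components. -/
structure DVF (n : ℕ) where
  a : E n → ℝ
  b : E n → Fin n → ℝ
  c : E n → Fin n → ℝ

/-- The actual vector field on `E` determined by the adapted components of a `DVF`. -/
def DVF.realize (M : E n → Fin n → ℝ) (N : E n → Fin n → Fin n → ℝ) (X : DVF n)
    (p : E n) : E n :=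
  (X.a p, X.b p, fun j => X.c p j - X.a p * M p j - ∑ i, X.b p i * N p i j)

/-- The nine families of adapted coefficients of a Γ-linear connection `∇`:
`Ḡ¹₁₁, G^k_{i1}, G^{(k)(1)}_{(1)(i)1}, L̄¹_{1j}, L^k_{ij}, L^{(k)(1)}_{(1)(i)j},
C̄^{1(1)}_{1(j)}, C^{k(1)}_{i(j)}, C^{(k)(1)(1)}_{(1)(i)(j)}`. -/
structure Conn (n : ℕ) where
  Gbar : E n → ℝ
  G : E n → Fin n → Fin n → ℝ
  Gv : E n → Fin n → Fin n → ℝ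
  Lbar : E n → Fin n → ℝ
  L : E n → Fin n → Fin n → Fin n → ℝ
  Lv : E n → Fin n → Fin n → Fin n → ℝ
  Cbar : E n → Fin n → ℝ
  C : E n → Fin n → Fin n → Fin n → ℝ
  Cv : E n → Fin n → Fin n → Fin n → ℝ

/-- All nine coefficient families are smooth. -/
def Conn.Smooth (K : Conn n) : Prop :=
  ContDiff ℝ (⊤ : ℕ∞) K.Gbar ∧ ContDiff ℝ (⊤ : ℕ∞) K.G ∧ ContDiff ℝ (⊤ : ℕ∞) K.Gv ∧ ContDiff ℝ (⊤ : ℕ∞) K.Lbar ∧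
  ContDiff ℝ (⊤ : ℕ∞) K.L ∧ ContDiff ℝ (⊤ : ℕ∞) K.Lv ∧ ContDiff ℝ (⊤ : ℕ∞) K.Cbar ∧ ContDiff ℝ (⊤ : ℕ∞) K.C ∧
  ContDiff ℝ (⊤ : ℕ∞) K.Cv

/-- Derivative `X(f)(p) := Df(p)(X(p))` of `f` along the realized vector field of `X`. -/
def Xder (M : E n → Fin n → ℝ) (N : E n → Fin n → Fin n → ℝ) (X : DVF n) (f : E n → ℝ)
    (p : E n) : ℝ := fderiv ℝ f p (X.realize M N p)

/-- The Γ-linear connection `∇_X W` in adapted components. -/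
def nabla (M : E n → Fin n → ℝ) (N : E n → Fin n → Fin n → ℝ) (K : Conn n)
    (X W : DVF n) : DVF n where
  a := fun p => Xder M N X W.a p +
    W.a p * (X.a p * K.Gbar p + ∑ j, X.b p j * K.Lbar p j + ∑ j, X.c p j * K.Cbar p j)
  b := fun p k => Xder M N X (fun q => W.b q k) p +
    ∑ i, W.b p i *
      (X.a p * K.G p k i + ∑ j, X.b p j * K.L p k i j + ∑ j, X.c p j * K.C p k i j)
  c := fun p k => Xder M N X (fun q => W.c q k) p +
    ∑ i, W.c p i *
      (X.a p * K.Gv p k i + ∑ j, X.b p j * K.Lv p k i j + ∑ j, X.c p j * K.Cv p k i j)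

/-- The adapted frame field `δ/δt` as a `DVF`. -/
def frT : DVF n := ⟨fun _ => 1, fun _ => 0, fun _ => 0⟩

/-- The adapted frame field `δ/δx^i` as a `DVF`. -/
def frX (i : Fin n) : DVF n := ⟨fun _ => 0, fun _ => Pi.single i 1, fun _ => 0⟩

/-- The adapted frame field `∂/∂y^i` as a `DVF`. -/
def frY (i : Fin n) : DVF n := ⟨fun _ => 0, fun _ => 0, fun _ => Pi.single i 1⟩

/-- Decomposition of an arbitrary vector field into adapted components. -/
def decomp (M : E n → Fin n → ℝ) (N : E n → Fin n → Fin n → ℝ) (V : E n → E n) : DVF n :=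
  ⟨fun p => (V p).1, fun p => (V p).2.1,
   fun p j => (V p).2.2 j + (V p).1 * M p j + ∑ i, (V p).2.1 i * N p i j⟩

/-- The torsion `T(X,Y) := ∇_X Y - ∇_Y X - [X,Y]`. -/
def torsion (M : E n → Fin n → ℝ) (N : E n → Fin n → Fin n → ℝ) (K : Conn n)
    (X Y : DVF n) (p : E n) : E n :=
  (nabla M N K X Y).realize M N p - (nabla M N K Y X).realize M N p -
    lieBr (X.realize M N) (Y.realize M N) p

/-- The curvature `R(X,Y)Z := ∇_X(∇_Y Z) - ∇_Y(∇_X Z) - ∇_{[X,Y]}Z`. -/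
def curv (M : E n → Fin n → ℝ) (N : E n → Fin n → Fin n → ℝ) (K : Conn n)
    (X Y Z : DVF n) (p : E n) : E n :=
  (nabla M N K X (nabla M N K Y Z)).realize M N p -
    (nabla M N K Y (nabla M N K X Z)).realize M N p -
    (nabla M N K (decomp M N (lieBr (X.realize M N) (Y.realize M N))) Z).realize M N p

/-- The horizontal spatial d-vector field `Σ_l B^l·δ/δx^l`. -/
def horX (B : E n → Fin n → ℝ) : DVF n := ⟨fun _ => 0, B, fun _ => 0⟩

lemma realize_frX (M : E n → Fin n → ℝ) (N : E n → Fin n → Fin n → ℝ) (j : Fin n) :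
    (frX j).realize M N = delX N j := by
  funext p
  simp [DVF.realize, frX, delX, Pi.single_apply]

lemma realize_frY (M : E n → Fin n → ℝ) (N : E n → Fin n → Fin n → ℝ) (k : Fin n) :
    (frY k).realize M N = delY k := by
  funext p
  simp [DVF.realize, frY, delY]

lemma realize_horX (M : E n → Fin n → ℝ) (N : E n → Fin n → Fin n → ℝ)
    (B : E n → Fin n → ℝ) (p : E n) :
    (horX B).realize M N p = ∑ l, B p l • delX N l p := by
  refine Prod.ext ?_ (Prod.ext ?_ ?_)
  · simp [DVF.realize, horX, delX, Prod.fst_sum]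
  · funext m
    simp [DVF.realize, horX, delX, Prod.fst_sum, Prod.snd_sum, Pi.single_apply]
  · funext m
    simp [DVF.realize, horX, delX, Prod.snd_sum]

lemma fderiv_delX (N : E n → Fin n → Fin n → ℝ) (f : E n → ℝ) (j : Fin n) (p : E n) :
    fderiv ℝ f p (delX N j p) = dX N f j p := by
  have h : delX N j p = ((0, Pi.single j 1, 0) : E n) -
      ∑ k, N p j k • ((0, 0, Pi.single k 1) : E n) := by
    refine Prod.ext ?_ (Prod.ext ?_ ?_)
    · simp [delX, Prod.fst_sum]
    · simp [delX, Prod.fst_sum, Prod.snd_sum]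
    · funext m
      simp [delX, Prod.snd_sum, Pi.single_apply]
  simp only [h, map_sub, map_sum, map_smul, smul_eq_mul, dX, pX, pY]

lemma lieBr_delY_delX {N : E n → Fin n → Fin n → ℝ} (hN : Differentiable ℝ N)
    (j k : Fin n) (p : E n) :
    lieBr (delY k) (delX N j) p = (0, 0, fun r => -pY (fun q => N q j r) k p) := by
  have hcoord : ∀ r, Differentiable ℝ fun q => N q j r := fun r => by fun_prop
  have hvert : HasFDerivAt (fun q r => -N q j r)
      (ContinuousLinearMap.pi fun r => -fderiv ℝ (fun q => N q j r) p) p :=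
    hasFDerivAt_pi.2 fun r => (hcoord r p).hasFDerivAt.neg
  have hX : HasFDerivAt (delX N j) _ p :=
    (hasFDerivAt_const (0 : ℝ) p).prodMk
      ((hasFDerivAt_const (Pi.single j 1 : Fin n → ℝ) p).prodMk hvert)
  have hY : fderiv ℝ (delY k : E n → E n) p = 0 :=
    fderiv_const_apply (((0 : ℝ), (0 : Fin n → ℝ), Pi.single k 1) : E n)
  rw [lieBr, hX.fderiv, hY]
  refine Prod.ext ?_ (Prod.ext ?_ ?_)
  · simp
  · simp
  · funext r
    simp [pY, delY]

lemma nabla_frX_right (M : E n → Fin n → ℝ) (N : E n → Fin n → Fin n → ℝ) (K : Conn n)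
    (X : DVF n) (i : Fin n) :
    nabla M N K X (frX i) = horX fun p l =>
      X.a p * K.G p l i + ∑ j, X.b p j * K.L p l i j + ∑ j, X.c p j * K.C p l i j := by
  simp [nabla, frX, horX, Xder, Pi.single_apply]
  rfl

lemma nabla_frX_horX (M : E n → Fin n → ℝ) (N : E n → Fin n → Fin n → ℝ) (K : Conn n)
    (B : E n → Fin n → ℝ) (j : Fin n) :
    nabla M N K (frX j) (horX B) = horX fun p l =>
      dX N (fun q => B q l) j p + ∑ r, B p r * K.L p l r j := by
  simp [nabla, horX, Xder, realize_frX, fderiv_delX]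
  simp [frX, Pi.single_apply]
  rfl

lemma nabla_frY_horX (M : E n → Fin n → ℝ) (N : E n → Fin n → Fin n → ℝ) (K : Conn n)
    (B : E n → Fin n → ℝ) (k : Fin n) :
    nabla M N K (frY k) (horX B) = horX fun p l =>
      pY (fun q => B q l) k p + ∑ r, B p r * K.C p l r k := by
  simp [nabla, horX, Xder, realize_frY]
  simp [frY, Pi.single_apply, pY, delY]
  rfl

/-- `R(∂/∂y^k, δ/δx^j) δ/δx^i = Σ_l P^l_{ijk}·δ/δx^l`, where
`P^l_{ijk} := ∂L^l_{ij}/∂y^k − C^l_{ik|j} + Σ_r C^l_{ir} P^r_{jk}`,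
`C^l_{ik|j} := δC^l_{ik}/δx^j + Σ_r C^r_{ik} L^l_{rj} − Σ_r C^l_{rk} L^r_{ij}
− Σ_r C^l_{ir} Lv^r_{kj}` and `P^r_{jk} := ∂N^r_j/∂y^k − Lv^r_{kj}`. -/
theorem curv_delY_delX_delX (n : ℕ) (M : E n → Fin n → ℝ) (N : E n → Fin n → Fin n → ℝ)
    (hM : ContDiff ℝ (⊤ : ℕ∞) M) (hN : ContDiff ℝ (⊤ : ℕ∞) N) (K : Conn n) (hK : K.Smooth) (i j k : Fin n) :
    curv M N K (frY k) (frX j) (frX i) = fun p =>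
      ∑ l, (pY (fun q => K.L q l i j) k p
        - (dX N (fun q => K.C q l i k) j p + (∑ r, K.C p r i k * K.L p l r j)
            - (∑ r, K.C p l r k * K.L p r i j) - ∑ r, K.C p l i r * K.Lv p r k j)
        + ∑ r, K.C p l i r *
            (pY (fun q => N q j r) k p - K.Lv p r k j)) • delX N l p := by
  funext p
  have hNd : Differentiable ℝ N := hN.differentiable (by simp)
  have hY : nabla M N K (frX j) (frX i) = horX fun q l => K.L q l i j := by
    rw [nabla_frX_right]
    simp [frX, Pi.single_apply]
  have hX : nabla M N K (frY k) (frX i) = horX fun q l => K.C q l i k := by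
    rw [nabla_frX_right]
    simp [frY, Pi.single_apply]
  rw [curv, hY, hX, nabla_frY_horX, nabla_frX_horX, nabla_frX_right, realize_frX,
    realize_frY, realize_horX, realize_horX, realize_horX, ← Finset.sum_sub_distrib,
    ← Finset.sum_sub_distrib]
  refine Finset.sum_congr rfl fun l _ => ?_
  rw [← sub_smul, ← sub_smul]
  congr 1
  simp only [decomp, lieBr_delY_delX hNd, Pi.zero_apply, zero_mul, add_zero,
    Finset.sum_const_zero, zero_add, mul_sub, Finset.sum_sub_distrib, neg_mul,
    Finset.sum_neg_distrib]
  simp only [mul_comm (K.L p _ i j), mul_comm (pY _ k p)]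
  ring
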